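/- arXiv:1808.04496 — 9 statements merged into one kernel-verified Lean document; each statement's English description precedes it below -/
import Mathlib

section
/- Let X be a finite set and N ≥ 2 an integer. A matrix γ : X × X → ℝ is called an N-representable 2-marginal if there exists a symmetric probability distribution μ on X^N (i.e., μ ≥ 0, its entries sum to 1, and μ is invariant under all permutations of its N indices) such that γ(x,y) = Σ_{x₃,...,x_N ∈ X} μ(x,y,x₃,...,x_N) for all x,y ∈ X. Then the set of N-representable 2-marginals equals conv(Γ₂), where Γ₂ = { (N/(N−1)) λλᵀ − (1/(N−1)) diag*(λ) : λ ∈ {0, 1/N, 2/N, ..., 1}^X, λᵀ𝟏 = 1 }. -/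
/-- The set of `N`-representable 2-marginals: matrices obtained by marginalizing a
symmetric probability distribution on `X^N` onto its first two coordinates. -/
def NRep2Marginals (X : Type*) [Fintype X] [DecidableEq X] (N : ℕ) (hN : 2 ≤ N) :
    Set (Matrix X X ℝ) :=
  { γ | ∃ μ : (Fin N → X) → ℝ,
      (∀ z, 0 ≤ μ z) ∧ (∑ z, μ z = 1) ∧
      (∀ (σ : Equiv.Perm (Fin N)) (z : Fin N → X), μ (z ∘ σ) = μ z) ∧
      (∀ x y : X, γ x y =
        ∑ z ∈ Finset.univ.filter
          (fun z : Fin N → X => z ⟨0, by omega⟩ = x ∧ z ⟨1, by omega⟩ = y), μ z) }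

/-- The set `Γ₂` of candidate extreme points. -/
def Gamma2 (X : Type*) [Fintype X] [DecidableEq X] (N : ℕ) : Set (Matrix X X ℝ) :=
  { γ | ∃ l : X → ℝ,
      (∀ i, ∃ k : ℕ, k ≤ N ∧ l i = (k : ℝ) / N) ∧ (∑ i, l i = 1) ∧
      γ = ((N : ℝ) / ((N : ℝ) - 1)) • Matrix.vecMulVec l l
          - (1 / ((N : ℝ) - 1)) • Matrix.diagonal l }

open Finset in
/-- The empirical pair matrix of a configuration `z`: the law of the values of `z` at a uniformly
random ordered pair of distinct positions. -/
noncomputable def empiricalPair {X : Type*} [DecidableEq X] {N : ℕ} (z : Fin N → X) :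
    Matrix X X ℝ :=
  ((N : ℝ) / ((N : ℝ) - 1)) • Matrix.vecMulVec
      (fun x => (#{i | z i = x} : ℝ) / N) (fun x => (#{i | z i = x} : ℝ) / N)
    - (1 / ((N : ℝ) - 1)) • Matrix.diagonal (fun x => (#{i | z i = x} : ℝ) / N)

open Finset in
theorem card_fiber_comp_perm {X : Type*} [DecidableEq X] {N : ℕ} (z : Fin N → X)
    (σ : Equiv.Perm (Fin N)) (x : X) :
    #{i | (z ∘ σ) i = x} = #{i | z i = x} :=
  card_equiv σ (by simp)

theorem empiricalPair_comp_perm {X : Type*} [DecidableEq X] {N : ℕ} (z : Fin N → X)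
    (σ : Equiv.Perm (Fin N)) : empiricalPair (z ∘ σ) = empiricalPair z := by
  unfold empiricalPair
  simp only [card_fiber_comp_perm]

open Finset in
theorem empiricalPair_mem_Gamma2 {X : Type*} [Fintype X] [DecidableEq X] {N : ℕ} (hN : 2 ≤ N)
    (z : Fin N → X) : empiricalPair z ∈ Gamma2 X N := by
  refine ⟨fun x => (#{i | z i = x} : ℝ) / N, fun x => ⟨_, ?_, rfl⟩, ?_, rfl⟩
  · simpa using card_le_univ ({i | z i = x} : Finset (Fin N))
  · have hN0 : (N : ℝ) ≠ 0 := by positivity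
    have h : ∑ x, #{i | z i = x} = N := by
      simpa using (card_eq_sum_card_fiberwise (s := univ) (t := univ) (f := z) (by simp)).symm
    rw [← sum_div, div_eq_one_iff_eq hN0]
    exact_mod_cast h

open Finset in
theorem sum_offDiag_pair_indicator {X : Type*} [DecidableEq X] {N : ℕ} (hN : 2 ≤ N)
    (z : Fin N → X) (x y : X) :
    ∑ p ∈ (univ : Finset (Fin N)).offDiag, (if z p.1 = x ∧ z p.2 = y then (1 : ℝ) else 0)
      = N * (N - 1) * empiricalPair z x y := by
  have hN2 : (2 : ℝ) ≤ N := by exact_mod_cast hN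
  have hN0 : (N : ℝ) ≠ 0 := by positivity
  have hN1 : (N : ℝ) - 1 ≠ 0 := by linarith
  have hall : ∑ p : Fin N × Fin N, (if z p.1 = x ∧ z p.2 = y then (1 : ℝ) else 0)
      = #{i | z i = x} * #{i | z i = y} := by
    rw [Fintype.sum_prod_type, ← Nat.cast_mul]
    simp only [card_filter, sum_mul_sum, Nat.cast_sum]
    refine sum_congr rfl fun i _ => sum_congr rfl fun j _ => ?_
    by_cases h : z i = x <;> by_cases h' : z j = y <;> simp [h, h']
  have hdiag : ∑ p ∈ (univ : Finset (Fin N)).diag,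
      (if z p.1 = x ∧ z p.2 = y then (1 : ℝ) else 0)
      = if x = y then (#{i | z i = x} : ℝ) else 0 := by
    rw [sum_diag]
    split_ifs with h
    · subst h
      simp
    · refine sum_eq_zero fun i _ => if_neg ?_
      rintro ⟨rfl, h'⟩
      exact h h'
  have hsplit : ∑ p : Fin N × Fin N, (if z p.1 = x ∧ z p.2 = y then (1 : ℝ) else 0)
      = ∑ p ∈ (univ : Finset (Fin N)).diag, (if z p.1 = x ∧ z p.2 = y then (1 : ℝ) else 0)
        + ∑ p ∈ (univ : Finset (Fin N)).offDiag,
          (if z p.1 = x ∧ z p.2 = y then (1 : ℝ) else 0) := by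
    rw [← univ_product_univ, ← diag_union_offDiag, sum_union (disjoint_diag_offDiag _)]
  rw [hall, hdiag] at hsplit
  rw [← sub_eq_iff_eq_add'.mpr hsplit]
  simp only [empiricalPair, Matrix.sub_apply, Matrix.smul_apply, Matrix.vecMulVec_apply,
    Matrix.diagonal_apply, smul_eq_mul]
  split_ifs <;> field_simp <;> ring

theorem exists_perm_apply_eq_apply_eq {α : Type*} [DecidableEq α] {a b i j : α}
    (hab : a ≠ b) (hij : i ≠ j) : ∃ σ : Equiv.Perm α, σ a = i ∧ σ b = j := by
  refine ⟨Equiv.swap (Equiv.swap a i b) j * Equiv.swap a i, ?_, ?_⟩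
  · rw [Equiv.Perm.mul_apply, Equiv.swap_apply_left]
    refine Equiv.swap_apply_of_ne_of_ne (fun h => hab ?_) hij
    exact (Equiv.swap a i).injective (by rw [← h, Equiv.swap_apply_left])
  · rw [Equiv.Perm.mul_apply, Equiv.swap_apply_left]

open Finset in
/-- The pair marginal of a symmetric weight is the mixture of the empirical pair matrices. -/
theorem pairMarginal_eq_sum_empiricalPair {X : Type*} [Fintype X] [DecidableEq X] {N : ℕ}
    (hN : 2 ≤ N) (μ : (Fin N → X) → ℝ)
    (hμ : ∀ (σ : Equiv.Perm (Fin N)) (z : Fin N → X), μ (z ∘ σ) = μ z)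
    {a b : Fin N} (hab : a ≠ b) (x y : X) :
    ∑ z with z a = x ∧ z b = y, μ z = ∑ z, μ z * empiricalPair z x y := by
  have hN2 : (2 : ℝ) ≤ N := by exact_mod_cast hN
  have hNN : (N : ℝ) * (N - 1) ≠ 0 := mul_ne_zero (by positivity) (by linarith)
  have hpair : ∀ p ∈ (univ : Finset (Fin N)).offDiag,
      ∑ z, μ z * (if z p.1 = x ∧ z p.2 = y then (1 : ℝ) else 0)
        = ∑ z with z a = x ∧ z b = y, μ z := by
    rintro ⟨i, j⟩ hp
    obtain ⟨σ, rfl, rfl⟩ := exists_perm_apply_eq_apply_eq hab (by simpa using hp)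
    rw [sum_filter]
    refine Fintype.sum_equiv (σ.symm.arrowCongr (Equiv.refl X)) _ _ fun z => ?_
    have hz : σ.symm.arrowCongr (Equiv.refl X) z = z ∘ σ := by
      ext
      simp [Equiv.arrowCongr]
    rw [hz, hμ]
    simp
  have hsum := sum_congr rfl hpair
  rw [sum_comm, sum_const, offDiag_card, nsmul_eq_mul] at hsum
  simp only [← mul_sum, sum_offDiag_pair_indicator hN] at hsum
  have hcard : ((#(univ : Finset (Fin N)) * #(univ : Finset (Fin N))
      - #(univ : Finset (Fin N)) : ℕ) : ℝ) = N * (N - 1) := by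
    rw [card_fin, Nat.cast_sub (Nat.le_mul_self N)]
    push_cast
    ring
  rw [hcard] at hsum
  refine mul_left_cancel₀ hNN ?_
  rw [← hsum, mul_sum]
  exact sum_congr rfl fun z _ => by ring

open Finset in
theorem exists_card_fiber_eq {X : Type*} [Fintype X] [DecidableEq X] {N : ℕ} (k : X → ℕ)
    (hk : ∑ x, k x = N) : ∃ z : Fin N → X, ∀ x, #{i | z i = x} = k x := by
  have e : Fin N ≃ Σ x, Fin (k x) := (Fintype.equivFinOfCardEq (by simpa using hk)).symm
  refine ⟨fun i => (e i).1, fun x => ?_⟩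
  rw [← Fintype.card_subtype]
  refine (Fintype.card_congr ((e.subtypeEquiv fun i => Iff.rfl).trans
    (Equiv.sigmaSubtype x))).trans (Fintype.card_fin _)

open Finset in
theorem exists_eq_empiricalPair_of_mem_Gamma2 {X : Type*} [Fintype X] [DecidableEq X] {N : ℕ}
    (hN : 2 ≤ N) {γ : Matrix X X ℝ} (hγ : γ ∈ Gamma2 X N) :
    ∃ z : Fin N → X, γ = empiricalPair z := by
  obtain ⟨l, hl, hsum, rfl⟩ := hγ
  choose k _ hk using hl
  have hN0 : (N : ℝ) ≠ 0 := by positivity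
  simp only [hk] at hsum
  rw [← sum_div, div_eq_one_iff_eq hN0] at hsum
  obtain ⟨z, hz⟩ := exists_card_fiber_eq (N := N) k (by exact_mod_cast hsum)
  refine ⟨z, ?_⟩
  obtain rfl : l = fun x => (k x : ℝ) / N := funext hk
  simp only [empiricalPair, hz]

open Finset in
theorem empiricalPair_mem_nRep2Marginals {X : Type*} [Fintype X] [DecidableEq X] {N : ℕ}
    (hN : 2 ≤ N) (z : Fin N → X) : empiricalPair z ∈ NRep2Marginals X N hN := by
  have hfact : (Fintype.card (Equiv.Perm (Fin N)) : ℝ) ≠ 0 :=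
    Nat.cast_ne_zero.mpr Fintype.card_ne_zero
  let μ : (Fin N → X) → ℝ := fun w =>
    (∑ σ : Equiv.Perm (Fin N), if z ∘ σ = w then (1 : ℝ) else 0)
      / Fintype.card (Equiv.Perm (Fin N))
  have hint : ∀ f : (Fin N → X) → ℝ, (∀ σ : Equiv.Perm (Fin N), f (z ∘ σ) = f z) →
      ∑ w, μ w * f w = f z := by
    intro f hf
    simp only [μ, div_mul_eq_mul_div, ← sum_div, sum_mul]
    rw [sum_comm]
    simp [hf, hfact]
  have hsymm : ∀ (σ : Equiv.Perm (Fin N)) (w : Fin N → X), μ (w ∘ σ) = μ w := by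
    intro σ w
    simp only [μ]
    congr 1
    refine Fintype.sum_equiv (Equiv.mulRight σ⁻¹) _ _ fun τ => ?_
    have hiff : z ∘ τ = w ∘ σ ↔ z ∘ (Equiv.mulRight σ⁻¹ τ : Equiv.Perm (Fin N)) = w := by
      rw [Equiv.coe_mulRight, Equiv.Perm.coe_mul, ← Function.comp_assoc]
      exact (Equiv.comp_symm_eq σ w (z ∘ τ)).symm
    simp only [hiff]
  refine ⟨μ, fun w => ?_, ?_, hsymm, fun x y => ?_⟩
  · exact div_nonneg (sum_nonneg fun σ _ => by split_ifs <;> norm_num) (Nat.cast_nonneg _)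
  · simpa using hint (fun _ => 1) fun _ => rfl
  · rw [pairMarginal_eq_sum_empiricalPair hN μ hsymm (by simp),
      hint (fun w => empiricalPair w x y) fun σ => by rw [empiricalPair_comp_perm]]

open Finset in
theorem convex_nRep2Marginals (X : Type*) [Fintype X] [DecidableEq X] (N : ℕ) (hN : 2 ≤ N) :
    Convex ℝ (NRep2Marginals X N hN) := by
  rintro γ ⟨μ, hμ0, hμ1, hμs, hμ⟩ δ ⟨ν, hν0, hν1, hνs, hν⟩ s t hs ht hst
  refine ⟨fun z => s * μ z + t * ν z, fun z => ?_, ?_, fun σ z => ?_, fun x y => ?_⟩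
  · exact add_nonneg (mul_nonneg hs (hμ0 z)) (mul_nonneg ht (hν0 z))
  · rw [sum_add_distrib, ← mul_sum, ← mul_sum, hμ1, hν1, mul_one, mul_one, hst]
  · simp only [hμs, hνs]
  · rw [sum_add_distrib, ← mul_sum, ← mul_sum, ← hμ, ← hν]
    simp

theorem nRep2Marginals_eq_convexHull_Gamma2
    (X : Type*) [Fintype X] [DecidableEq X] (N : ℕ) (hN : 2 ≤ N) :
    NRep2Marginals X N hN = convexHull ℝ (Gamma2 X N) := by
  refine Set.Subset.antisymm ?_ (convexHull_min ?_ (convex_nRep2Marginals X N hN))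
  · rintro γ ⟨μ, hμ0, hμ1, hμs, hμ⟩
    have hγ : γ = ∑ z, μ z • empiricalPair z := by
      ext x y
      rw [hμ, pairMarginal_eq_sum_empiricalPair hN μ hμs (by simp), Matrix.sum_apply]
      rfl
    rw [hγ]
    exact (convex_convexHull ℝ _).sum_mem (fun z _ => hμ0 z) hμ1
      fun z _ => subset_convexHull ℝ _ (empiricalPair_mem_Gamma2 hN z)
  · intro γ hγ
    obtain ⟨z, rfl⟩ := exists_eq_empiricalPair_of_mem_Gamma2 hN hγ
    exact empiricalPair_mem_nRep2Marginals hN z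
end

section
/- Let X be a finite set and N ≥ 2 an integer. Let Γ₂ = { (N/(N−1)) λλᵀ − (1/(N−1)) diag*(λ) : λ ∈ {0, 1/N, 2/N, ..., 1}^X, λᵀ𝟏 = 1 }. Then Γ₂ is exactly the set of extreme points of conv(Γ₂). -/
/-- A point at which a linear functional attains its strict minimum over `S` is an extreme point of
the convex hull of `S`. -/
theorem mem_extremePoints_convexHull_of_forall_lt {E : Type*} [AddCommGroup E] [Module ℝ E]
    {S : Set E} {a : E} (F : E →ₗ[ℝ] ℝ) (ha : a ∈ S) (hF : ∀ s ∈ S, s ≠ a → F a < F s) :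
    a ∈ Set.extremePoints ℝ (convexHull ℝ S) := by
  have hconv : Convex ℝ {y | y = a ∨ F a < F y} := by
    rw [convex_iff_forall_pos]
    rintro x hx y hy s t hs ht hst
    rcases hx with rfl | hx <;> rcases hy with rfl | hy
    · left
      rw [← add_smul, hst, one_smul]
    all_goals
      right
      simp only [map_add, map_smul, smul_eq_mul]
      obtain rfl : s = 1 - t := by linarith
      nlinarith
  have hsub : convexHull ℝ S ⊆ {y | y = a ∨ F a < F y} :=
    convexHull_min (fun s hs => or_iff_not_imp_left.2 (hF s hs)) hconv
  rw [mem_extremePoints_iff_left]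
  refine ⟨subset_convexHull ℝ S ha, ?_⟩
  rintro x hx y hy ⟨s, t, hs, ht, hst, hxy⟩
  refine (hsub hx).resolve_right fun hlt => ?_
  have hle : F a ≤ F y := (hsub hy).elim (fun h => h ▸ le_rfl) le_of_lt
  have hval : F a = s * F x + t * F y := by
    simp [← hxy]
  obtain rfl : s = 1 - t := by linarith
  nlinarith

/-- A linear functional whose value at the element of `Gamma2` with parameter `m` is
`∑ i, (m i - l i) ^ 2 - ∑ i, l i ^ 2`. -/
noncomputable def separatingFunctional {X : Type*} [Fintype X] (N : ℕ) (l : X → ℝ) :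
    Matrix X X ℝ →ₗ[ℝ] ℝ where
  toFun γ := ∑ i, (((N : ℝ) - 1) / N * γ i i + (1 / N - 2 * l i) * ∑ j, γ i j)
  map_add' γ δ := by
    simp only [Matrix.add_apply, Finset.sum_add_distrib, mul_add]
    ring
  map_smul' c γ := by
    simp only [Matrix.smul_apply, smul_eq_mul, RingHom.id_apply, Finset.mul_sum, mul_add]
    simp only [mul_left_comm c]

theorem separatingFunctional_apply {X : Type*} [Fintype X] [DecidableEq X] {N : ℕ} (hN : 2 ≤ N)
    (l : X → ℝ) {m : X → ℝ} (hm : ∑ i, m i = 1) :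
    separatingFunctional N l (((N : ℝ) / ((N : ℝ) - 1)) • Matrix.vecMulVec m m
      - (1 / ((N : ℝ) - 1)) • Matrix.diagonal m) = ∑ i, (m i - l i) ^ 2 - ∑ i, l i ^ 2 := by
  have hN' : (2 : ℝ) ≤ N := by exact_mod_cast hN
  have h0 : (N : ℝ) ≠ 0 := by positivity
  have h1 : (N : ℝ) - 1 ≠ 0 := by linarith
  simp only [separatingFunctional, LinearMap.coe_mk, AddHom.coe_mk]
  rw [← Finset.sum_sub_distrib]
  refine Finset.sum_congr rfl fun i _ => ?_
  simp only [Matrix.sub_apply, Matrix.smul_apply, Matrix.vecMulVec_apply, smul_eq_mul,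
    Finset.sum_sub_distrib, ← Finset.mul_sum, hm, Matrix.diagonal_apply, Finset.sum_ite_eq,
    Finset.mem_univ, if_true]
  field_simp
  ring

theorem Gamma2_eq_extremePoints_convexHull
    (X : Type*) [Fintype X] [DecidableEq X] (N : ℕ) (hN : 2 ≤ N) :
    Gamma2 X N = Set.extremePoints ℝ (convexHull ℝ (Gamma2 X N)) := by
  refine Set.Subset.antisymm ?_ extremePoints_convexHull_subset
  intro γ hγ
  obtain ⟨l, -, hl, hγl⟩ := id hγ
  refine mem_extremePoints_convexHull_of_forall_lt (separatingFunctional N l) hγ ?_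
  rintro _ ⟨m, -, hm, rfl⟩ hne
  rw [hγl, separatingFunctional_apply hN l hl, separatingFunctional_apply hN l hm]
  have hml : m ≠ l := by
    rintro rfl
    exact hne hγl.symm
  obtain ⟨i, hi⟩ := Function.ne_iff.1 hml
  have hpos : 0 < ∑ i, (m i - l i) ^ 2 :=
    Finset.sum_pos' (fun _ _ => sq_nonneg _)
      ⟨i, Finset.mem_univ i, sq_pos_of_ne_zero (sub_ne_zero.2 hi)⟩
  simpa using hpos
end

section
/- Let X be a finite set and N ≥ 2 an integer with N ≤ |X|. Let B_N(X) = { λ ∈ ℝ^X : λᵀ𝟏 = 1 and λ(i) ∈ {0, 1/N} for each i ∈ X }, and let Γ̃₂ = { (N/(N−1)) λλᵀ − (1/(N−1)) diag*(λ) : λ ∈ B_N(X) }. Then Γ̃₂ is exactly the set of extreme points of conv(Γ̃₂). -/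
/-- The set of binarized probability vectors on `X` with entries in `{0, 1/N}`. -/
def BN (X : Type*) [Fintype X] (N : ℕ) : Set (X → ℝ) :=
  { l | (∑ i, l i = 1) ∧ ∀ i, l i = 0 ∨ l i = 1 / N }

/-- The set `Γ̃₂`. -/
def GammaTilde2 (X : Type*) [Fintype X] [DecidableEq X] (N : ℕ) : Set (Matrix X X ℝ) :=
  { γ | ∃ l ∈ BN X N,
      γ = ((N : ℝ) / ((N : ℝ) - 1)) • Matrix.vecMulVec l l
          - (1 / ((N : ℝ) - 1)) • Matrix.diagonal l }

/-- Every entry of an element of `Γ̃₂` is either `0` or `1 / (N (N - 1))`. -/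
theorem GammaTilde2_apply_eq_zero_or {X : Type*} [Fintype X] [DecidableEq X] {N : ℕ}
    (hN : 2 ≤ N) {γ : Matrix X X ℝ} (hγ : γ ∈ GammaTilde2 X N) (i j : X) :
    γ i j = 0 ∨ γ i j = 1 / ((N : ℝ) * ((N : ℝ) - 1)) := by
  have hN' : (2 : ℝ) ≤ N := by exact_mod_cast hN
  have h0 : (N : ℝ) ≠ 0 := by positivity
  have h1 : (N : ℝ) - 1 ≠ 0 := by linarith
  obtain ⟨l, ⟨-, hl⟩, rfl⟩ := hγ
  simp only [Matrix.sub_apply, Matrix.smul_apply, Matrix.vecMulVec_apply, smul_eq_mul]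
  by_cases hij : i = j
  · subst hij
    left
    rcases hl i with h | h <;> simp only [Matrix.diagonal_apply_eq, h] <;> field_simp <;> ring
  · rw [Matrix.diagonal_apply_ne _ hij]
    rcases hl i with h | h
    · simp [h]
    rcases hl j with h' | h'
    · simp [h']
    right
    rw [h, h']
    field_simp
    ring

/-- The endpoints of `[a, b]` are extreme points of `[a, b]`. -/
theorem mem_extremePoints_Icc_of_eq_or_eq {a b x : ℝ} (hab : a ≤ b) (hx : x = a ∨ x = b) :
    x ∈ (Set.Icc a b).extremePoints ℝ := by
  rw [mem_extremePoints_iff_left]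
  refine ⟨by rcases hx with rfl | rfl <;> simp [hab], ?_⟩
  rintro y ⟨hy, hy'⟩ z ⟨hz, hz'⟩ ⟨s, t, hs, ht, hst, h⟩
  simp only [smul_eq_mul] at h
  obtain rfl : t = 1 - s := by linarith
  rcases hx with rfl | rfl <;> nlinarith

/-- In a set of real matrices with entries in `{a, b}`, every element is an extreme point of the
convex hull. -/
theorem subset_extremePoints_convexHull_of_apply_eq_or_eq {m n : Type*} {a b : ℝ} (hab : a ≤ b)
    {S : Set (Matrix m n ℝ)} (hS : ∀ γ ∈ S, ∀ i j, γ i j = a ∨ γ i j = b) :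
    S ⊆ (convexHull ℝ S).extremePoints ℝ := by
  let box : Set (m → n → ℝ) := Set.univ.pi fun _ => Set.univ.pi fun _ => Set.Icc a b
  have hbox : Convex ℝ box := convex_pi fun _ _ => convex_pi fun _ _ => convex_Icc a b
  have hext : S ⊆ box.extremePoints ℝ := by
    intro γ hγ
    simp only [box, extremePoints_pi]
    exact fun i _ j _ => mem_extremePoints_Icc_of_eq_or_eq hab (hS γ hγ i j)
  have hsub : convexHull ℝ S ⊆ box := convexHull_min (hext.trans extremePoints_subset) hbox
  exact fun γ hγ => inter_extremePoints_subset_extremePoints_of_subset hsub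
    ⟨subset_convexHull ℝ S hγ, hext hγ⟩

theorem GammaTilde2_eq_extremePoints_convexHull
    (X : Type*) [Fintype X] [DecidableEq X] (N : ℕ) (hN : 2 ≤ N)
    (hNX : N ≤ Fintype.card X) :
    GammaTilde2 X N = Set.extremePoints ℝ (convexHull ℝ (GammaTilde2 X N)) := by
  have hN' : (2 : ℝ) ≤ N := by exact_mod_cast hN
  have hc : (0 : ℝ) ≤ 1 / ((N : ℝ) * ((N : ℝ) - 1)) :=
    one_div_nonneg.mpr (mul_nonneg (by linarith) (by linarith))
  exact Set.Subset.antisymm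
    (subset_extremePoints_convexHull_of_apply_eq_or_eq hc fun _ hγ i j =>
      GammaTilde2_apply_eq_zero_or hN hγ i j)
    extremePoints_convexHull_subset
end

section
/- Let X be a finite set and N ≥ 2 an integer with N ≤ |X|. Let B_N(X) = { λ ∈ ℝ^X : λᵀ𝟏 = 1 and λ(i) ∈ {0, 1/N} for each i ∈ X }, let Γ̃₂ = { (N/(N−1)) λλᵀ − (1/(N−1)) diag*(λ) : λ ∈ B_N(X) }, and let D = { (N/(N−1)) Λ − (1/(N−1)) diag*(Λ𝟏) : Λ ∈ ℝ^{X×X}, Λ positive semidefinite, Λ entrywise nonnegative, 𝟏ᵀΛ𝟏 = 1, diag(Λ) = (1/N) Λ𝟏 }. Then Γ̃₂ is a subset of the set of extreme points of D. -/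
/-- The feasible set `D` of the SDP relaxation (without the linear constraint). -/
def SDPDomain (X : Type*) [Fintype X] [DecidableEq X] (N : ℕ) : Set (Matrix X X ℝ) :=
  { γ | ∃ Λ : Matrix X X ℝ,
      Λ.PosSemidef ∧ (∀ i j, 0 ≤ Λ i j) ∧ (∑ i, ∑ j, Λ i j = 1) ∧
      (∀ i, Λ i i = (1 / (N : ℝ)) * ∑ j, Λ i j) ∧
      γ = ((N : ℝ) / ((N : ℝ) - 1)) • Λ
          - (1 / ((N : ℝ) - 1)) • Matrix.diagonal (Λ.mulVec (fun _ => 1)) }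

/-- If a convex combination of two positive semidefinite matrices is the rank-one matrix `l lᵀ`
with `∑ i, l i = 1`, then the first matrix is `l lᵀ` as soon as its entries sum to `1`. -/
theorem Matrix.PosSemidef.eq_vecMulVec_of_smul_add_smul_eq {X : Type*} [Fintype X]
    {A B : Matrix X X ℝ} {l : X → ℝ} {a b : ℝ} (hA : A.PosSemidef) (hB : B.PosSemidef)
    (ha : 0 < a) (hb : 0 ≤ b) (hl : ∑ i, l i = 1) (hA1 : ∑ i, ∑ j, A i j = 1)
    (h : a • A + b • B = Matrix.vecMulVec l l) : A = Matrix.vecMulVec l l := by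
  classical
  have ker (v : X → ℝ) (hv : l ⬝ᵥ v = 0) : A.mulVec v = 0 := by
    have hA0 := hA.dotProduct_mulVec_nonneg v
    have hB0 := hB.dotProduct_mulVec_nonneg v
    have key : a * (star v ⬝ᵥ A.mulVec v) + b * (star v ⬝ᵥ B.mulVec v) = 0 := by
      have := congrArg (fun M : Matrix X X ℝ => star v ⬝ᵥ M.mulVec v) h
      simpa [Matrix.add_mulVec, Matrix.smul_mulVec, Matrix.vecMulVec_mulVec, hv] using this
    refine (hA.dotProduct_mulVec_zero_iff v).1 (le_antisymm ?_ hA0)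
    nlinarith [mul_nonneg hb hB0]
  have col (i j : X) : A i j = l j * ∑ k, A i k := by
    have hv := ker (Pi.single j 1 - l j • fun _ => 1) (by
      simp [dotProduct, mul_sub, Finset.sum_sub_distrib, ← Finset.sum_mul, Pi.single_apply, hl])
    have := congrFun hv i
    simp only [Matrix.mulVec_sub, Matrix.mulVec_smul, Matrix.mulVec_single_one] at this
    simpa [Matrix.mulVec, dotProduct, sub_eq_zero] using this
  have symm (i j : X) : A j i = A i j := by simpa using hA.isHermitian.apply i j
  have row (i : X) : ∑ k, A i k = l i := by
    calc ∑ k, A i k = ∑ k, A k i := Finset.sum_congr rfl fun k _ => symm k i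
      _ = ∑ k, l i * ∑ m, A k m := Finset.sum_congr rfl fun k _ => col k i
      _ = l i := by rw [← Finset.mul_sum, hA1, mul_one]
  ext i j
  rw [col, row, Matrix.vecMulVec_apply, mul_comm]

/-- The linear map recovering `Λ` from `(N/(N-1)) Λ - (1/(N-1)) diag*(Λ𝟏)`. -/
noncomputable def SDPDomain.lift {X : Type*} [Fintype X] [DecidableEq X] (N : ℕ) :
    Matrix X X ℝ →ₗ[ℝ] Matrix X X ℝ where
  toFun γ := (((N : ℝ) - 1) / N) • γ + (1 / (N : ℝ)) • Matrix.diagonal (γ.mulVec fun _ => 1)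
  map_add' γ δ := by
    have hd := Matrix.diagonal_add (γ.mulVec fun _ => (1 : ℝ)) (δ.mulVec fun _ => 1)
    rw [Matrix.add_mulVec, Pi.add_def, ← hd]
    module
  map_smul' c γ := by
    rw [Matrix.smul_mulVec, Matrix.diagonal_smul, RingHom.id_apply]
    module

theorem SDPDomain.lift_apply_of_two_le {X : Type*} [Fintype X] [DecidableEq X] {N : ℕ}
    (hN : 2 ≤ N) (A : Matrix X X ℝ) :
    SDPDomain.lift N (((N : ℝ) / ((N : ℝ) - 1)) • A
      - (1 / ((N : ℝ) - 1)) • Matrix.diagonal (A.mulVec fun _ => 1)) = A := by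
  have h2 : (2 : ℝ) ≤ N := by exact_mod_cast hN
  have h0 : (N : ℝ) ≠ 0 := by linarith
  have h1 : (N : ℝ) - 1 ≠ 0 := by linarith
  have hd : (Matrix.diagonal (A.mulVec fun _ => (1 : ℝ))).mulVec (fun _ => 1)
      = A.mulVec fun _ => 1 := by
    ext i
    simp [Matrix.mulVec_diagonal]
  simp only [SDPDomain.lift, LinearMap.coe_mk, AddHom.coe_mk, Matrix.sub_mulVec,
    Matrix.smul_mulVec, hd]
  ext i j
  by_cases hij : i = j
  · subst hij
    simp
    field_simp
    ring
  · simp [hij]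
    field_simp

theorem BN.vecMulVec_mulVec_one {X : Type*} [Fintype X] {N : ℕ} {l : X → ℝ} (hl : l ∈ BN X N) :
    (Matrix.vecMulVec l l).mulVec (fun _ => 1) = l := by
  ext i
  simp [Matrix.mulVec, dotProduct, Matrix.vecMulVec_apply, ← Finset.mul_sum, hl.1]

theorem GammaTilde2_subset_SDPDomain (X : Type*) [Fintype X] [DecidableEq X] (N : ℕ) :
    GammaTilde2 X N ⊆ SDPDomain X N := by
  rintro _ ⟨l, hl, rfl⟩
  have hnn (i : X) : 0 ≤ l i := by
    rcases hl.2 i with h | h <;> rw [h]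
    positivity
  refine ⟨Matrix.vecMulVec l l, ?_, fun i j => ?_, ?_, fun i => ?_, ?_⟩
  · simpa using Matrix.posSemidef_vecMulVec_self_star l
  · exact mul_nonneg (hnn i) (hnn j)
  · simp [Matrix.vecMulVec_apply, ← Finset.mul_sum, hl.1]
  · rcases hl.2 i with h | h <;> simp [Matrix.vecMulVec_apply, ← Finset.mul_sum, hl.1, h]
  · rw [BN.vecMulVec_mulVec_one hl]

theorem GammaTilde2_subset_extremePoints_SDPDomain
    (X : Type*) [Fintype X] [DecidableEq X] (N : ℕ) (hN : 2 ≤ N)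
    (hNX : N ≤ Fintype.card X) :
    GammaTilde2 X N ⊆ Set.extremePoints ℝ (SDPDomain X N) := by
  intro γ hγ
  refine mem_extremePoints_iff_left.2 ⟨GammaTilde2_subset_SDPDomain X N hγ, ?_⟩
  obtain ⟨l, hl, rfl⟩ := hγ
  rintro _ ⟨A, hA, -, hA1, -, rfl⟩ _ ⟨B, hB, -, -, -, rfl⟩ ⟨a, b, ha, hb, -, hab⟩
  have hsum : a • A + b • B = Matrix.vecMulVec l l := by
    have hl' := SDPDomain.lift_apply_of_two_le hN (Matrix.vecMulVec l l)
    rw [BN.vecMulVec_mulVec_one hl, ← hab, map_add, map_smul, map_smul,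
      SDPDomain.lift_apply_of_two_le hN, SDPDomain.lift_apply_of_two_le hN] at hl'
    exact hl'
  rw [hA.eq_vecMulVec_of_smul_add_smul_eq hB ha hb.le hl.1 hA1 hsum,
    BN.vecMulVec_mulVec_one hl]
end

section
/- Let X be a finite set and N ≥ 2 an integer with N ≤ |X|. Let Π̃_{N,sym} be the set of symmetric probability distributions μ on X^N (μ ≥ 0, entries summing to 1, invariant under all permutations of the N indices) satisfying μ(i₁,...,i_N) = 0 whenever i_k = i_l for some k ≠ l. Let Γ̃_N = { (1/N!) Σ_{σ ∈ S(N)} e_{c_{σ(1)}} ⊗ ⋯ ⊗ e_{c_{σ(N)}} : c₁,...,c_N ∈ X pairwise distinct }, where e_c ∈ ℝ^X is the indicator vector of c and S(N) is the symmetric group on N elements. Then Π̃_{N,sym} = conv(Γ̃_N). -/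
/-- Symmetric probability distributions on `X^N` vanishing whenever two indices coincide. -/
def PiTildeSym (X : Type*) [Fintype X] [DecidableEq X] (N : ℕ) :
    Set ((Fin N → X) → ℝ) :=
  { μ | (∀ z, 0 ≤ μ z) ∧ (∑ z, μ z = 1) ∧
      (∀ (σ : Equiv.Perm (Fin N)) (z : Fin N → X), μ (z ∘ σ) = μ z) ∧
      (∀ z : Fin N → X, (∃ k l : Fin N, k ≠ l ∧ z k = z l) → μ z = 0) }

/-- The symmetrized point masses on pairwise-distinct configurations. -/
def GammaTildeN (X : Type*) [Fintype X] [DecidableEq X] (N : ℕ) :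
    Set ((Fin N → X) → ℝ) :=
  { μ | ∃ c : Fin N → X, Function.Injective c ∧
      μ = fun z => (1 / (N.factorial : ℝ)) *
        ∑ σ : Equiv.Perm (Fin N), ∏ k, (if z k = c (σ k) then (1 : ℝ) else 0) }

/-- The symmetrization of the point mass at a configuration `c`. -/
noncomputable def symPointMass {X : Type*} [DecidableEq X] {N : ℕ} (c : Fin N → X) :
    (Fin N → X) → ℝ :=
  fun z => (1 / (N.factorial : ℝ)) *
    ∑ σ : Equiv.Perm (Fin N), ∏ k, (if z k = c (σ k) then (1 : ℝ) else 0)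

theorem symPointMass_apply {X : Type*} [DecidableEq X] {N : ℕ} (c z : Fin N → X) :
    symPointMass c z = (1 / (N.factorial : ℝ)) *
      ∑ σ : Equiv.Perm (Fin N), (if z = c ∘ σ then (1 : ℝ) else 0) := by
  simp only [symPointMass, Finset.prod_ite_zero, Finset.prod_const_one, Finset.mem_univ,
    forall_true_left, funext_iff, Function.comp_apply]

theorem convex_piTildeSym (X : Type*) [Fintype X] [DecidableEq X] (N : ℕ) :
    Convex ℝ (PiTildeSym X N) := by
  rintro μ ⟨hμ, hμ1, hμs, hμd⟩ ν ⟨hν, hν1, hνs, hνd⟩ a b ha hb hab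
  refine ⟨fun z => ?_, ?_, fun σ z => ?_, fun z hz => ?_⟩
  · exact add_nonneg (mul_nonneg ha (hμ z)) (mul_nonneg hb (hν z))
  · simp [Finset.sum_add_distrib, ← Finset.mul_sum, hμ1, hν1, hab]
  · simp [hμs, hνs]
  · simp [hμd z hz, hνd z hz]

theorem symPointMass_mem_piTildeSym {X : Type*} [Fintype X] [DecidableEq X] {N : ℕ}
    {c : Fin N → X} (hc : Function.Injective c) : symPointMass c ∈ PiTildeSym X N := by
  refine ⟨fun z => ?_, ?_, fun τ z => ?_, fun z hz => ?_⟩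
  · rw [symPointMass_apply]
    positivity
  · simp only [symPointMass_apply]
    rw [← Finset.mul_sum, Finset.sum_comm]
    simp [Fintype.card_perm, Nat.factorial_ne_zero]
  · simp only [symPointMass_apply]
    congr 1
    refine Fintype.sum_equiv (Equiv.mulRight τ⁻¹) _ _ fun σ => ?_
    congr 1
    refine propext ⟨fun h => ?_, fun h => ?_⟩
    · funext k
      simpa using congrFun h (τ⁻¹ k)
    · funext k
      simp [h]
  · obtain ⟨k, l, hkl, hz⟩ := hz
    rw [symPointMass_apply, Finset.sum_eq_zero, mul_zero]
    intro σ _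
    refine if_neg fun h => hkl ?_
    subst h
    exact σ.injective (hc hz)

/-- A symmetric tensor is the combination of symmetrized point masses weighted by its entries. -/
theorem sum_smul_symPointMass {X : Type*} [Fintype X] [DecidableEq X] {N : ℕ}
    {μ : (Fin N → X) → ℝ}
    (hμ : ∀ (σ : Equiv.Perm (Fin N)) (z : Fin N → X), μ (z ∘ σ) = μ z) :
    ∑ c, μ c • symPointMass c = μ := by
  funext z
  have key (σ : Equiv.Perm (Fin N)) :
      ∑ c : Fin N → X, μ c * (if z = c ∘ σ then (1 : ℝ) else 0) = μ z := by
    rw [Finset.sum_eq_single (z ∘ σ.symm)]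
    · simp [hμ, Function.comp_assoc]
    · rintro c - hc
      rw [if_neg, mul_zero]
      rintro rfl
      exact hc (by simp [Function.comp_assoc])
    · simp
  have hN : (N.factorial : ℝ) ≠ 0 := by positivity
  simp only [Finset.sum_apply, Pi.smul_apply, smul_eq_mul, symPointMass_apply,
    mul_left_comm (μ _)]
  rw [← Finset.mul_sum]
  simp only [Finset.mul_sum _ _ (μ _)]
  rw [Finset.sum_comm]
  simp only [key]
  simp [Fintype.card_perm, hN]

theorem piTildeSym_eq_convexHull_GammaTildeN
    (X : Type*) [Fintype X] [DecidableEq X] (N : ℕ) (hN : 2 ≤ N)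
    (hNX : N ≤ Fintype.card X) :
    PiTildeSym X N = convexHull ℝ (GammaTildeN X N) := by
  classical
  refine Set.Subset.antisymm ?_ (convexHull_min ?_ (convex_piTildeSym X N))
  · rintro μ ⟨hμ, hμ1, hμs, hμd⟩
    have hzero (c : Fin N → X) (hc : ¬ Function.Injective c) : μ c = 0 := by
      simp only [Function.Injective, not_forall] at hc
      obtain ⟨k, l, hkl, hne⟩ := hc
      exact hμd c ⟨k, l, hne, hkl⟩
    rw [← sum_smul_symPointMass hμs,
      ← Finset.sum_filter_of_ne (p := Function.Injective) fun c _ h => by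
        contrapose! h
        rw [hzero c h, zero_smul]]
    refine (convex_convexHull ℝ _).sum_mem (fun c _ => hμ c) ?_ fun c hc =>
      subset_convexHull ℝ _ ⟨c, (Finset.mem_filter.1 hc).2, rfl⟩
    rw [← hμ1]
    exact Finset.sum_filter_of_ne fun c _ h => by
      contrapose! h
      exact hzero c h
  · rintro _ ⟨c, hc, rfl⟩
    exact symPointMass_mem_piTildeSym hc
end

section
/- Let X be a finite set, N ≥ 3 an integer, and c₁,...,c_N ∈ X pairwise distinct. Let μ = (1/N!) Σ_{σ ∈ S(N)} e_{c_{σ(1)}} ⊗ ⋯ ⊗ e_{c_{σ(N)}} and let λ = (1/N) Σ_{i=1}^N e_{c_i}. Then the 3-marginal of μ, namely κ(i,j,k) = Σ_{l₄,...,l_N ∈ X} μ(i,j,k,l₄,...,l_N), equals (1/(N(N−1)(N−2))) [ N³ λ⊗λ⊗λ + 2N Σ_{l∈X} λ(l) e_l⊗e_l⊗e_l − N² Σ_{l∈X} λ(l) ( λ⊗e_l⊗e_l + e_l⊗λ⊗e_l + e_l⊗e_l⊗λ ) ]. -/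
/-- Indicator (standard basis) vector of `c ∈ X`. -/
def stdBasis {X : Type*} [DecidableEq X] (c : X) : X → ℝ :=
  fun x => if x = c then 1 else 0

open Finset in
/-- The number of permutations of `β` that extend a given partial injection `ι a ↦ p a`. -/
theorem card_perm_extending_mul_descFactorial {β : Type*} [Fintype β] [DecidableEq β] {n : ℕ}
    (ι p : Fin n ↪ β) :
    #{σ : Equiv.Perm β | ι.trans σ.toEmbedding = p} * (Fintype.card β).descFactorial n
      = (Fintype.card β).factorial := by
  have h_ext (q : Fin n ↪ β) : ∃ g : Equiv.Perm β, ι.trans g.toEmbedding = q := by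
    obtain ⟨g, hg⟩ := (Equiv.Perm.isMultiplyPretransitive β n).exists_smul_eq ι q
    exact ⟨g, by rw [← hg]; rfl⟩
  have h_eq (q : Fin n ↪ β) :
      #{σ : Equiv.Perm β | ι.trans σ.toEmbedding = q}
        = #{σ : Equiv.Perm β | ι.trans σ.toEmbedding = ι} := by
    obtain ⟨g, rfl⟩ := h_ext q
    symm
    refine card_equiv (Equiv.mulLeft g) fun σ => ?_
    simp [DFunLike.ext_iff]
  have h_sum := card_eq_sum_card_fiberwise (s := (univ : Finset (Equiv.Perm β)))
    (f := fun σ => ι.trans σ.toEmbedding) (t := univ) (by simp [Set.MapsTo])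
  simp only [h_eq, sum_const, card_univ, Fintype.card_perm, Fintype.card_embedding_eq,
    Fintype.card_fin, smul_eq_mul] at h_sum
  rw [h_eq, h_sum, mul_comm]

/-- The probability that a uniformly random permutation maps three given distinct points to
three prescribed ones. -/
theorem card_perm_three_points_div_factorial {N : ℕ} (hN : 3 ≤ N) {x y z a b d : Fin N}
    (hxy : x ≠ y) (hxz : x ≠ z) (hyz : y ≠ z) (hab : a ≠ b) (had : a ≠ d) (hbd : b ≠ d) :
    (1 / (N.factorial : ℝ)) *
        ((Finset.univ.filter fun σ : Equiv.Perm (Fin N) => σ x = a ∧ σ y = b ∧ σ z = d).card : ℝ)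
      = 1 / ((N : ℝ) * ((N : ℝ) - 1) * ((N : ℝ) - 2)) := by
  have h_inj {u v w : Fin N} (huv : u ≠ v) (huw : u ≠ w) (hvw : v ≠ w) :
      Function.Injective ![u, v, w] := by
    intro s t
    fin_cases s <;> fin_cases t <;> simp [huv, huw, hvw, huv.symm, huw.symm, hvw.symm]
  have h := card_perm_extending_mul_descFactorial
    ⟨![x, y, z], h_inj hxy hxz hyz⟩ ⟨![a, b, d], h_inj hab had hbd⟩
  have h_iff (σ : Equiv.Perm (Fin N)) :
      (⟨![x, y, z], h_inj hxy hxz hyz⟩ : Fin 3 ↪ Fin N).trans σ.toEmbedding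
          = ⟨![a, b, d], h_inj hab had hbd⟩ ↔ σ x = a ∧ σ y = b ∧ σ z = d := by
    simp [DFunLike.ext_iff, Fin.forall_fin_succ]
  simp only [h_iff, Fintype.card_fin] at h
  obtain ⟨M, rfl⟩ := Nat.exists_eq_add_of_le' hN
  have h_real := congrArg (Nat.cast (R := ℝ)) h
  simp only [Nat.descFactorial] at h_real
  rw [Nat.cast_mul] at h_real
  have h_pos : ((M + 3).factorial : ℝ) ≠ 0 := by positivity
  have h_desc : (((M + 3 - 2) * ((M + 3 - 1) * ((M + 3 - 0) * 1)) : ℕ) : ℝ)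
      = ((M + 3 : ℕ) : ℝ) * (((M + 3 : ℕ) : ℝ) - 1) * (((M + 3 : ℕ) : ℝ) - 2) := by
    rw [show M + 3 - 2 = M + 1 by omega, show M + 3 - 1 = M + 2 by omega]
    push_cast
    ring
  rw [h_desc] at h_real
  rw [← h_real] at h_pos ⊢
  have h_ne' := left_ne_zero_of_mul h_pos
  rw [one_div_mul_eq_div, div_mul_eq_div_div, div_self h_ne']

/-- Summing a point mass over a set of configurations tests membership of its support. -/
theorem sum_filter_prod_indicator {ι X : Type*} [Fintype ι] [DecidableEq ι] [Fintype X]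
    [DecidableEq X] (P : (ι → X) → Prop) [DecidablePred P] (w : ι → X) :
    ∑ z ∈ Finset.univ.filter P, ∏ k, (if z k = w k then (1 : ℝ) else 0)
      = if P w then 1 else 0 := by
  have h_prod (z : ι → X) :
      ∏ k, (if z k = w k then (1 : ℝ) else 0) = if z = w then 1 else 0 := by
    simp [Finset.prod_boole, funext_iff]
  simp only [h_prod, Finset.sum_ite_eq', Finset.mem_filter, Finset.mem_univ, true_and]

theorem sum_stdBasis_apply {ι X : Type*} [Fintype ι] [DecidableEq X] {c : ι → X}
    (hc : Function.Injective c) (x : X) [Decidable (x ∈ Set.range c)] :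
    ∑ i, stdBasis (c i) x = if x ∈ Set.range c then 1 else 0 := by
  classical
  split_ifs with hx
  · obtain ⟨a, rfl⟩ := hx
    simp [stdBasis, hc.eq_iff]
  · refine Finset.sum_eq_zero fun i _ => if_neg ?_
    rintro rfl
    exact hx ⟨i, rfl⟩

theorem threeMarginal_of_symmetrized_point_mass
    (X : Type*) [Fintype X] [DecidableEq X] (N : ℕ) (hN : 3 ≤ N)
    (c : Fin N → X) (hc : Function.Injective c)
    (μ : (Fin N → X) → ℝ)
    (hμ : μ = fun z => (1 / (N.factorial : ℝ)) *
        ∑ σ : Equiv.Perm (Fin N), ∏ k, (if z k = c (σ k) then (1 : ℝ) else 0))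
    (lam : X → ℝ)
    (hlam : lam = fun x => (1 / (N : ℝ)) * ∑ i : Fin N, stdBasis (c i) x) :
    ∀ i j k : X,
      (∑ z ∈ Finset.univ.filter
          (fun z : Fin N → X =>
            z ⟨0, by omega⟩ = i ∧ z ⟨1, by omega⟩ = j ∧ z ⟨2, by omega⟩ = k), μ z)
      = (1 / ((N : ℝ) * ((N : ℝ) - 1) * ((N : ℝ) - 2))) *
          ((N : ℝ) ^ 3 * (lam i * lam j * lam k)
            + 2 * (N : ℝ) *
              ∑ l : X, lam l * (stdBasis l i * stdBasis l j * stdBasis l k)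
            - (N : ℝ) ^ 2 *
              ∑ l : X, lam l *
                (lam i * stdBasis l j * stdBasis l k
                  + stdBasis l i * lam j * stdBasis l k
                  + stdBasis l i * stdBasis l j * lam k)) := by
  classical
  intro i j k
  have hN0 : (N : ℝ) ≠ 0 := by
    have : N ≠ 0 := by omega
    exact_mod_cast this
  have h_lam (x : X) : lam x = (1 / (N : ℝ)) * if x ∈ Set.range c then 1 else 0 := by
    rw [hlam, ← sum_stdBasis_apply hc]
  have h_lhs : (∑ z ∈ Finset.univ.filter
          (fun z : Fin N → X =>
            z ⟨0, by omega⟩ = i ∧ z ⟨1, by omega⟩ = j ∧ z ⟨2, by omega⟩ = k), μ z)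
      = (1 / (N.factorial : ℝ)) *
        ((Finset.univ.filter fun σ : Equiv.Perm (Fin N) =>
          c (σ ⟨0, by omega⟩) = i ∧ c (σ ⟨1, by omega⟩) = j ∧ c (σ ⟨2, by omega⟩) = k).card : ℝ) := by
    rw [hμ, ← Finset.mul_sum, Finset.sum_comm]
    simp only [sum_filter_prod_indicator _ fun k => c (_ : Fin N), Finset.sum_boole]
  have h_diag : ∑ l : X, lam l * (stdBasis l i * stdBasis l j * stdBasis l k)
      = lam i * (if i = j ∧ i = k then 1 else 0) := by
    rw [Finset.sum_eq_single i (by intro l _ hl; simp [stdBasis, hl.symm]) (by simp)]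
    simp only [stdBasis, eq_comm (b := i), if_true]
    by_cases hij : i = j <;> by_cases hik : i = k <;> simp [hij, hik]
  have h_pairs : ∑ l : X, lam l *
                (lam i * stdBasis l j * stdBasis l k
                  + stdBasis l i * lam j * stdBasis l k
                  + stdBasis l i * stdBasis l j * lam k)
      = lam i * lam j * (if j = k then 1 else 0) + lam i * lam j * (if i = k then 1 else 0)
        + lam i * lam k * (if i = j then 1 else 0) := by
    simp only [mul_add, Finset.sum_add_distrib]
    congr 1
    · congr 1
      · rw [Finset.sum_eq_single j (by intro l _ hl; simp [stdBasis, hl.symm]) (by simp)]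
        simp only [stdBasis, eq_comm (a := k), if_true]
        ring
      · rw [Finset.sum_eq_single i (by intro l _ hl; simp [stdBasis, hl.symm]) (by simp)]
        simp only [stdBasis, eq_comm (a := k), if_true]
        ring
    · rw [Finset.sum_eq_single i (by intro l _ hl; simp [stdBasis, hl.symm]) (by simp)]
      simp only [stdBasis, eq_comm (a := j), if_true]
      ring
  rw [h_lhs, h_diag, h_pairs]
  by_cases h_range : (i ∈ Set.range c ∧ j ∈ Set.range c ∧ k ∈ Set.range c) ∧
      i ≠ j ∧ i ≠ k ∧ j ≠ k
  · obtain ⟨⟨⟨a, rfl⟩, ⟨b, rfl⟩, ⟨d, rfl⟩⟩, hij, hik, hjk⟩ := h_range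
    simp only [hc.eq_iff]
    rw [card_perm_three_points_div_factorial hN (by simp) (by simp) (by simp)
      (hc.ne_iff.mp hij) (hc.ne_iff.mp hik) (hc.ne_iff.mp hjk)]
    have h_eval (a : Fin N) : lam (c a) = 1 / (N : ℝ) := by
      simp [h_lam]
    simp only [h_eval, hc.ne_iff.mp hij, hc.ne_iff.mp hik, hc.ne_iff.mp hjk, false_and, if_false]
    field_simp
    ring
  · rw [Finset.filter_false_of_mem, Finset.card_empty, Nat.cast_zero, mul_zero]
    · symm
      refine mul_eq_zero_of_right _ ?_
      have h_or (x : X) : lam x = 0 ∨ lam x = 1 / (N : ℝ) := by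
        rw [h_lam]
        split_ifs <;> simp
      by_cases hij : i = j
      · subst hij
        by_cases hik : i = k
        · subst hik
          rcases h_or i with h | h <;> simp only [h, and_self, if_true]
          · ring
          · field_simp
            ring
        · rcases h_or i with h | h <;> simp only [h, hik, and_false, if_true, if_false]
          · ring
          · field_simp
            ring
      · by_cases hik : i = k
        · subst hik
          rcases h_or i with h | h <;> simp only [h, hij, Ne.symm hij, false_and, if_true, if_false]
          · ring
          · field_simp
            ring
        · by_cases hjk : j = k
          · subst hjk
            rcases h_or j with h | h <;> simp only [h, hij, false_and, if_true, if_false]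
            · ring
            · field_simp
              ring
          · have h_zero : lam i * lam j * lam k = 0 := by
              by_cases hi : i ∈ Set.range c
              · by_cases hj : j ∈ Set.range c
                · have hk : k ∉ Set.range c := fun hk =>
                    h_range ⟨⟨hi, hj, hk⟩, hij, hik, hjk⟩
                  rw [h_lam k, if_neg hk, mul_zero, mul_zero]
                · rw [h_lam j, if_neg hj, mul_zero, mul_zero, zero_mul]
              · rw [h_lam i, if_neg hi, mul_zero, zero_mul, zero_mul]
            simp only [h_zero, hij, hik, hjk, false_and, if_false]
            ring
    · rintro σ - ⟨rfl, rfl, rfl⟩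
      exact h_range (by simp [hc.eq_iff])
end

section
/- Let X be a finite set, N ≥ 2 an integer, and c₁,...,c_N ∈ X pairwise distinct. Let μ = (1/N!) Σ_{σ ∈ S(N)} e_{c_{σ(1)}} ⊗ ⋯ ⊗ e_{c_{σ(N)}} and let λ = (1/N) Σ_{i=1}^N e_{c_i}. Then the 2-marginal of μ, namely γ(i,j) = Σ_{l₃,...,l_N ∈ X} μ(i,j,l₃,...,l_N), equals (N/(N−1)) λλᵀ − (1/(N−1)) diag*(λ). -/
/-- Summing a function of two distinct entries of a permutation over all permutations gives the
same value for every choice of the two positions. -/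
theorem sum_perm_apply_pair_eq {α M : Type*} [Fintype α] [DecidableEq α] [AddCommMonoid M]
    (f : α → α → M) {a b a' b' : α} (hab : a ≠ b) (hab' : a' ≠ b') :
    ∑ σ : Equiv.Perm α, f (σ a) (σ b) = ∑ σ : Equiv.Perm α, f (σ a') (σ b') := by
  obtain ⟨τ, hτa, hτb⟩ := MulAction.is_two_pretransitive_iff.mp
    (Equiv.Perm.isMultiplyPretransitive α 2) hab' hab
  rw [← Equiv.sum_comp (Equiv.mulRight τ) (fun σ : Equiv.Perm α => f (σ a') (σ b'))]
  simp only [Equiv.Perm.smul_def] at hτa hτb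
  simp [hτa, hτb]

/-- Each ordered pair of distinct elements occurs equally often as the entries of a permutation at
two fixed positions. -/
theorem card_mul_sum_perm_apply_pair {α : Type*} [Fintype α] [DecidableEq α]
    (f : α → α → ℝ) {a b : α} (hab : a ≠ b) :
    ((Fintype.card α : ℝ) * ((Fintype.card α : ℝ) - 1)) *
        ∑ σ : Equiv.Perm α, f (σ a) (σ b) =
      ((Fintype.card α).factorial : ℝ) * ∑ p ∈ (Finset.univ : Finset α).offDiag, f p.1 p.2 := by
  have hperm : ∀ σ : Equiv.Perm α,
      ∑ p ∈ (Finset.univ : Finset α).offDiag, f (σ p.1) (σ p.2) =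
        ∑ p ∈ (Finset.univ : Finset α).offDiag, f p.1 p.2 := fun σ =>
    Finset.sum_equiv (Equiv.prodCongr σ σ) (by simp) (by simp)
  have hcard : (((Finset.univ : Finset α).offDiag.card : ℕ) : ℝ) =
      (Fintype.card α : ℝ) * ((Fintype.card α : ℝ) - 1) := by
    rw [Finset.offDiag_card, Nat.cast_sub (Nat.le_mul_self _)]
    push_cast [Finset.card_univ]
    ring
  calc _ = ∑ p ∈ (Finset.univ : Finset α).offDiag,
        ∑ σ : Equiv.Perm α, f (σ p.1) (σ p.2) := by
        rw [← hcard, ← nsmul_eq_mul, ← Finset.sum_const]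
        refine Finset.sum_congr rfl fun p hp => ?_
        exact sum_perm_apply_pair_eq f hab (by simpa using hp)
    _ = _ := by
        rw [Finset.sum_comm, Finset.sum_congr rfl fun σ _ => hperm σ]
        simp [Fintype.card_perm]

/-- Off-diagonal double sum of a product of two functions. -/
theorem sum_offDiag_mul {α : Type*} [Fintype α] [DecidableEq α] (u v : α → ℝ) :
    ∑ p ∈ (Finset.univ : Finset α).offDiag, u p.1 * v p.2 =
      (∑ p, u p) * (∑ q, v q) - ∑ p, u p * v p := by
  rw [eq_sub_iff_add_eq, Fintype.sum_mul_sum, ← Finset.sum_product',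
    ← Finset.diag_union_offDiag, Finset.sum_union (Finset.disjoint_diag_offDiag _),
    Finset.sum_diag, add_comm]

theorem twoMarginal_of_symmetrized_point_mass
    (X : Type*) [Fintype X] [DecidableEq X] (N : ℕ) (hN : 2 ≤ N)
    (c : Fin N → X) (hc : Function.Injective c)
    (μ : (Fin N → X) → ℝ)
    (hμ : μ = fun z => (1 / (N.factorial : ℝ)) *
        ∑ σ : Equiv.Perm (Fin N), ∏ k, (if z k = c (σ k) then (1 : ℝ) else 0))
    (lam : X → ℝ)
    (hlam : lam = fun x => (1 / (N : ℝ)) * ∑ i : Fin N, stdBasis (c i) x) :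
    (Matrix.of fun i j : X =>
        ∑ z ∈ Finset.univ.filter
          (fun z : Fin N → X => z ⟨0, by omega⟩ = i ∧ z ⟨1, by omega⟩ = j), μ z)
      = ((N : ℝ) / ((N : ℝ) - 1)) • Matrix.vecMulVec lam lam
          - (1 / ((N : ℝ) - 1)) • Matrix.diagonal lam := by
  have hN2 : (2 : ℝ) ≤ N := by exact_mod_cast hN
  have hN0 : (N : ℝ) ≠ 0 := by positivity
  have hN1 : (N : ℝ) - 1 ≠ 0 := by linarith
  have hfac : (N.factorial : ℝ) ≠ 0 := by positivity
  have hsum : ∀ x, ∑ p, stdBasis (c p) x = N * lam x := fun x => by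
    rw [hlam]; field_simp
  ext i j
  have hmarginal : ∑ z ∈ Finset.univ.filter
      (fun z : Fin N → X => z ⟨0, by omega⟩ = i ∧ z ⟨1, by omega⟩ = j), μ z =
      (1 / (N.factorial : ℝ)) * ∑ σ : Equiv.Perm (Fin N),
        stdBasis (c (σ ⟨0, by omega⟩)) i * stdBasis (c (σ ⟨1, by omega⟩)) j := by
    simp only [hμ]
    rw [← Finset.mul_sum, Finset.sum_comm]
    congr 1
    refine Finset.sum_congr rfl fun σ _ => ?_
    simp only [Fintype.prod_boole, ← funext_iff (g := fun k => c (σ k)), stdBasis,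
      Finset.sum_ite_eq', Finset.mem_filter, Finset.mem_univ, true_and, ← ite_and, mul_ite,
      mul_one, mul_zero]
    split_ifs <;> simp_all
  have hpair := card_mul_sum_perm_apply_pair
    (fun p q : Fin N => stdBasis (c p) i * stdBasis (c q) j)
    (a := ⟨0, by omega⟩) (b := ⟨1, by omega⟩) (by simp)
  rw [sum_offDiag_mul (fun p => stdBasis (c p) i) (fun q => stdBasis (c q) j), hsum, hsum,
    Fintype.card_fin] at hpair
  have hdiag : ∑ p, stdBasis (c p) i * stdBasis (c p) j = N * Matrix.diagonal lam i j := by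
    rw [Matrix.diagonal_apply]
    split_ifs with hij
    · subst hij
      rw [← hsum]
      refine Finset.sum_congr rfl fun p _ => ?_
      simp only [stdBasis]
      split_ifs <;> simp
    · rw [mul_zero]
      refine Finset.sum_eq_zero fun p _ => ?_
      simp only [stdBasis]
      split_ifs <;> simp_all
  rw [hdiag] at hpair
  simp only [Matrix.of_apply, Matrix.sub_apply, Matrix.smul_apply, Matrix.vecMulVec_apply,
    smul_eq_mul]
  rw [hmarginal]
  generalize (∑ σ : Equiv.Perm (Fin N), _ : ℝ) = S at hpair ⊢
  field_simp
  apply mul_left_cancel₀ hN0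
  linarith
end

section
/- Let X be a finite set, N ≥ 2 an integer, C : X × X → ℝ a symmetric cost function, and μ a symmetric probability distribution on X^N (μ ≥ 0, entries summing to 1, invariant under all permutations of its N indices). Let γ(x,y) = Σ_{x₃,...,x_N ∈ X} μ(x,y,x₃,...,x_N) denote the 2-marginal of μ. Then Σ_{(x₁,...,x_N) ∈ X^N} ( Σ_{1 ≤ j < i ≤ N} C(x_i, x_j) ) μ(x₁,...,x_N) = (N(N−1)/2) Σ_{x,y ∈ X} C(x,y) γ(x,y). -/
/-- Under a symmetric weight, the sum of a two-coordinate observable does not depend on which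
ordered pair of distinct coordinates is observed. -/
theorem sum_pair_mul_eq_of_symmetric {ι X : Type*} [Fintype ι] [DecidableEq ι] [Fintype X]
    (C : X → X → ℝ) (μ : (ι → X) → ℝ)
    (hsym : ∀ (σ : Equiv.Perm ι) (z : ι → X), μ (z ∘ σ) = μ z)
    {a b i j : ι} (hab : a ≠ b) (hij : i ≠ j) :
    ∑ z : ι → X, C (z i) (z j) * μ z = ∑ z : ι → X, C (z a) (z b) * μ z := by
  obtain ⟨σ, ha, hb⟩ := MulAction.is_two_pretransitive_iff.mp
    (Equiv.Perm.isMultiplyPretransitive ι 2) hab hij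
  refine Fintype.sum_equiv (σ.symm.arrowCongr (Equiv.refl X)) _ _ fun z => ?_
  have hz : σ.symm.arrowCongr (Equiv.refl X) z = z ∘ σ := rfl
  rw [hz, hsym, ← ha, ← hb]
  rfl

/-- Integrating an observable against the marginal under `f` and `g` amounts to summing its
pullback against the weight. -/
theorem sum_mul_sum_filter_eq {Z X : Type*} [Fintype Z] [Fintype X] [DecidableEq X]
    (C : X → X → ℝ) (μ : Z → ℝ) (f g : Z → X) :
    ∑ x : X, ∑ y : X, C x y * ∑ z ∈ Finset.univ.filter (fun z => f z = x ∧ g z = y), μ z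
      = ∑ z, C (f z) (g z) * μ z := by
  simp only [Finset.sum_filter, Finset.mul_sum]
  simp_rw [Finset.sum_comm (s := (Finset.univ : Finset X)) (t := (Finset.univ : Finset Z))]
  refine Finset.sum_congr rfl fun z _ => ?_
  simp [ite_and]

/-- A constant summed over the pairs `j < i` in `Fin N`. -/
theorem sum_sum_ite_lt_fin (N : ℕ) (c : ℝ) :
    (∑ i : Fin N, ∑ j : Fin N, if j < i then c else 0) = (N : ℝ) * ((N : ℝ) - 1) / 2 * c := by
  have h (i : Fin N) : (∑ j : Fin N, if j < i then c else 0) = (i : ℝ) * c := by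
    rw [← Finset.sum_filter, Finset.sum_const, Finset.filter_gt_eq_Iio, Fin.card_Iio,
      nsmul_eq_mul]
  simp_rw [h]
  rw [← Finset.sum_mul, Fin.sum_univ_eq_sum_range (fun k => (k : ℝ))]
  congr 1
  clear h
  induction N with
  | zero => simp
  | succ n ih =>
    rw [Finset.sum_range_succ, ih]
    push_cast
    ring

theorem pairwise_cost_eq_twoMarginal_cost
    (X : Type*) [Fintype X] [DecidableEq X] (N : ℕ) (hN : 2 ≤ N)
    (C : X → X → ℝ) (hC : ∀ x y, C x y = C y x)
    (μ : (Fin N → X) → ℝ)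
    (hpos : ∀ z, 0 ≤ μ z) (hnorm : ∑ z, μ z = 1)
    (hsym : ∀ (σ : Equiv.Perm (Fin N)) (z : Fin N → X), μ (z ∘ σ) = μ z)
    (γ : X → X → ℝ)
    (hγ : ∀ x y : X, γ x y =
      ∑ z ∈ Finset.univ.filter
        (fun z : Fin N → X => z ⟨0, by omega⟩ = x ∧ z ⟨1, by omega⟩ = y), μ z) :
    ∑ z : Fin N → X,
        (∑ i : Fin N, ∑ j : Fin N, if j < i then C (z i) (z j) else 0) * μ z
      = ((N : ℝ) * ((N : ℝ) - 1) / 2) * ∑ x : X, ∑ y : X, C x y * γ x y := by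
  simp_rw [hγ]
  rw [sum_mul_sum_filter_eq C μ (fun z => z ⟨0, by omega⟩) (fun z => z ⟨1, by omega⟩),
    ← sum_sum_ite_lt_fin]
  simp_rw [Finset.sum_mul]
  rw [Finset.sum_comm]
  refine Finset.sum_congr rfl fun i _ => ?_
  rw [Finset.sum_comm]
  refine Finset.sum_congr rfl fun j _ => ?_
  split_ifs with hji
  · exact sum_pair_mul_eq_of_symmetric C μ hsym (by simp) hji.ne'
  · simp
end

section
/- Let L ≥ 1 and let λ₁,...,λ_L ∈ ℝ^L be a basis of ℝ^L. Let a ∈ ℝ^L with a(i) ≠ 0 for all i, let w₁, w₂ ∈ ℝ^L with w₂ᵀλᵢ ≠ 0 for all i, and let Θ = Σ_{i=1}^L a(i) λᵢ ⊗ λᵢ ⊗ λᵢ. Define W_s = Σ_{k=1}^L w_s(k) Θ(·,·,k) for s = 1,2. Then W₂ is invertible, and for every j, λⱼ is an eigenvector of W₁W₂⁻¹ with eigenvalue (w₁ᵀλⱼ)/(w₂ᵀλⱼ), i.e., W₁W₂⁻¹ λⱼ = ((w₁ᵀλⱼ)/(w₂ᵀλⱼ)) λⱼ. -/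
open Matrix

/-- Contracting the third mode of `∑ s, a s • (lam s ⊗ lam s ⊗ lam s)` against `w` gives a matrix
that is congruent to a diagonal one. -/
theorem contraction_eq_transpose_mul_diagonal_mul {ι n R : Type*} [Fintype ι] [DecidableEq ι]
    [Fintype n] [CommSemiring R] (lam : ι → n → R) (a : ι → R) (w : n → R) :
    (Matrix.of fun i j => ∑ k, w k * ∑ s, a s * (lam s i * lam s j * lam s k)) =
      (Matrix.of lam)ᵀ * diagonal (fun s => a s * (w ⬝ᵥ lam s)) * Matrix.of lam := by
  ext i j
  rw [Matrix.mul_apply]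
  simp only [mul_diagonal, transpose_apply, of_apply, dotProduct,
    Finset.mul_sum, Finset.sum_mul]
  rw [Finset.sum_comm]
  exact Finset.sum_congr rfl fun s _ => Finset.sum_congr rfl fun k _ => by ring

/-- The columns of `M⁻¹` are mapped by `Mᵀ * diagonal d * M` to multiples of the rows of `M`. -/
theorem transpose_mul_diagonal_mul_mulVec_inv_col {n R : Type*} [Fintype n] [DecidableEq n]
    [CommRing R] {M : Matrix n n R} (hM : IsUnit M) (d : n → R) (j : n) :
    (Mᵀ * diagonal d * M) *ᵥ M⁻¹.col j = d j • M j := by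
  have hdet : IsUnit M.det := (isUnit_iff_isUnit_det M).mp hM
  rw [← mulVec_single_one, mulVec_mulVec, Matrix.mul_assoc, mul_nonsing_inv _ hdet,
    Matrix.mul_one, mulVec_single_one]
  ext i
  simp [col_apply, mul_diagonal, mul_comm]

theorem jenrich_eigenvectors
    (L : ℕ) (hL : 1 ≤ L) (lam : Fin L → (Fin L → ℝ))
    (hindep : LinearIndependent ℝ lam)
    (hspan : Submodule.span ℝ (Set.range lam) = ⊤)
    (a : Fin L → ℝ) (ha : ∀ i, a i ≠ 0)
    (w₁ w₂ : Fin L → ℝ) (hw₂ : ∀ i, w₂ ⬝ᵥ lam i ≠ 0)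
    (Θ : Fin L → Fin L → Fin L → ℝ)
    (hΘ : Θ = fun i j k => ∑ s, a s * (lam s i * lam s j * lam s k))
    (W₁ W₂ : Matrix (Fin L) (Fin L) ℝ)
    (hW₁ : W₁ = Matrix.of fun i j => ∑ k, w₁ k * Θ i j k)
    (hW₂ : W₂ = Matrix.of fun i j => ∑ k, w₂ k * Θ i j k) :
    IsUnit W₂ ∧
    ∀ j : Fin L, (W₁ * W₂⁻¹).mulVec (lam j) = ((w₁ ⬝ᵥ lam j) / (w₂ ⬝ᵥ lam j)) • lam j := by
  have hM : IsUnit (Matrix.of lam) := linearIndependent_rows_iff_isUnit.mp hindep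
  subst hΘ
  rw [contraction_eq_transpose_mul_diagonal_mul] at hW₁ hW₂
  have hunit : IsUnit W₂ := by
    rw [hW₂]
    refine (((isUnit_transpose _).mpr hM).mul (isUnit_diagonal.mpr ?_)).mul hM
    exact Pi.isUnit_iff.mpr fun i => (mul_ne_zero (ha i) (hw₂ i)).isUnit
  refine ⟨hunit, fun j => ?_⟩
  have h₁ := transpose_mul_diagonal_mul_mulVec_inv_col hM (fun s => a s * (w₁ ⬝ᵥ lam s)) j
  have h₂ := transpose_mul_diagonal_mul_mulVec_inv_col hM (fun s => a s * (w₂ ⬝ᵥ lam s)) j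
  rw [← hW₁] at h₁
  rw [← hW₂] at h₂
  change _ = _ • lam j at h₁ h₂
  have hinv : (Matrix.of lam)⁻¹.col j = (a j * (w₂ ⬝ᵥ lam j)) • (W₂⁻¹ *ᵥ lam j) := by
    rw [← mulVec_smul, ← h₂, mulVec_mulVec,
      nonsing_inv_mul _ ((isUnit_iff_isUnit_det W₂).mp hunit), one_mulVec]
  rw [hinv, mulVec_smul, mulVec_mulVec] at h₁
  apply smul_right_injective _ (mul_ne_zero (ha j) (hw₂ j))
  simp only [h₁, smul_smul]
  congr 1
  field_simp [hw₂ j]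
end
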